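/- arXiv:2510.08794 — 6 statements merged into one kernel-verified Lean document; each statement's English description precedes it below -/
import Mathlib

section
/- Fix ε > 0. With q*(p) = sup{ q ∈ [0,1] : d(q,p) ≤ ε }, one has lim_{p→0⁺} q*(p) · log(ε/p) / ε = 1; equivalently, lim_{p→0⁺} log(ε/p) / (ε / q*(p)) = 1. -/
/-- The Bernoulli Kullback–Leibler divergence. -/
noncomputable def bernKL (q p : ℝ) : ℝ :=
  q * Real.log (q / p) + (1 - q) * Real.log ((1 - q) / (1 - p))

/-- `q*(p) = sup{ q ∈ [0,1] : d(q,p) ≤ ε }`. -/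
noncomputable def qStar (ε p : ℝ) : ℝ :=
  sSup {q : ℝ | q ∈ Set.Icc (0:ℝ) 1 ∧ bernKL q p ≤ ε}

/-- As a function of `q`, the divergence is an affine function minus the binary entropy. -/
theorem bernKL_eq_sub_binEntropy {q p : ℝ} (hp0 : 0 < p) (hp1 : p < 1) :
    bernKL q p = q * (-Real.log p) + (1 - q) * (-Real.log (1 - p)) - Real.binEntropy q := by
  have hp : p ≠ 0 := hp0.ne'
  have hp' : 1 - p ≠ 0 := by linarith
  have h1 : q * Real.log (q / p) = q * Real.log q - q * Real.log p := by
    rcases eq_or_ne q 0 with rfl | hq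
    · simp
    · rw [Real.log_div hq hp]; ring
  have h2 : (1 - q) * Real.log ((1 - q) / (1 - p))
      = (1 - q) * Real.log (1 - q) - (1 - q) * Real.log (1 - p) := by
    rcases eq_or_ne (1 - q) 0 with hq | hq
    · simp [hq]
    · rw [Real.log_div hq hp']; ring
  rw [bernKL, h1, h2, Real.binEntropy, Real.log_inv, Real.log_inv]
  ring

/-- The largest point of a nonempty sublevel set of a continuous function on `[0, 1]` lies in the
set, and the level is attained there unless that point is `1`. -/
theorem sSup_sublevel_spec {f : ℝ → ℝ} (hf : Continuous f) {ε : ℝ} (h0 : f 0 ≤ ε) :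
    sSup {q : ℝ | q ∈ Set.Icc (0:ℝ) 1 ∧ f q ≤ ε} ∈ Set.Icc (0:ℝ) 1 ∧
      f (sSup {q : ℝ | q ∈ Set.Icc (0:ℝ) 1 ∧ f q ≤ ε}) ≤ ε ∧
      (sSup {q : ℝ | q ∈ Set.Icc (0:ℝ) 1 ∧ f q ≤ ε} < 1 →
        f (sSup {q : ℝ | q ∈ Set.Icc (0:ℝ) 1 ∧ f q ≤ ε}) = ε) := by
  set S := {q : ℝ | q ∈ Set.Icc (0:ℝ) 1 ∧ f q ≤ ε} with hS
  have hbdd : BddAbove S := ⟨1, fun q hq => hq.1.2⟩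
  have hne : S.Nonempty := ⟨0, ⟨le_rfl, zero_le_one⟩, h0⟩
  have hcl : IsClosed S := isClosed_Icc.inter (isClosed_le hf continuous_const)
  have hmem : sSup S ∈ S := hcl.csSup_mem hne hbdd
  refine ⟨hmem.1, hmem.2, fun hlt => hmem.2.eq_of_not_lt fun hfs => ?_⟩
  have h1 : ∀ᶠ q in nhds (sSup S), f q < ε := hf.continuousAt.eventually_lt_const hfs
  have h2 : ∀ᶠ q in nhds (sSup S), q < 1 := eventually_lt_nhds hlt
  obtain ⟨q, ⟨hq1, hq2⟩, hq3⟩ :=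
    (((h1.and h2).filter_mono nhdsWithin_le_nhds).and
      (self_mem_nhdsWithin : Set.Ioi (sSup S) ∈ nhdsWithin (sSup S) (Set.Ioi (sSup S)))).exists
  have hq3' : sSup S < q := hq3
  exact absurd (le_csSup hbdd ⟨⟨hmem.1.1.trans hq3'.le, hq2.le⟩, hq1.le⟩) (not_le.2 hq3')

theorem qStar_spec {ε p : ℝ} (hp0 : 0 < p) (hp1 : p < 1) (h : -Real.log (1 - p) ≤ ε) :
    qStar ε p ∈ Set.Icc (0:ℝ) 1 ∧ bernKL (qStar ε p) p ≤ ε ∧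
      (qStar ε p < 1 → bernKL (qStar ε p) p = ε) := by
  have hf : Continuous fun q => bernKL q p := by
    simp only [bernKL_eq_sub_binEntropy hp0 hp1]
    fun_prop
  refine sSup_sublevel_spec hf ?_
  simpa [bernKL_eq_sub_binEntropy hp0 hp1] using h

/-- Fix `ε > 0`. Then `lim_{p→0⁺} q*(p)·log(ε/p)/ε = 1`. -/
theorem stmt1 (ε : ℝ) (hε : 0 < ε) :
    Filter.Tendsto (fun p : ℝ => qStar ε p * Real.log (ε / p) / ε)
      (nhdsWithin 0 (Set.Ioi 0)) (nhds 1) := by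
  have hN : Filter.Tendsto (fun p : ℝ => -Real.log (1 - p)) (nhdsWithin 0 (Set.Ioi 0))
      (nhds 0) := by
    have : ContinuousAt (fun p : ℝ => -Real.log (1 - p)) 0 :=
      ((continuousAt_const.sub continuousAt_id).log (by simp)).neg
    simpa using this.tendsto.mono_left nhdsWithin_le_nhds
  have hM : Filter.Tendsto (fun p : ℝ => -Real.log p) (nhdsWithin 0 (Set.Ioi 0)) Filter.atTop :=
    Filter.tendsto_neg_atBot_atTop.comp Real.tendsto_log_nhdsGT_zero
  have hpos : ∀ᶠ p : ℝ in nhdsWithin 0 (Set.Ioi 0), 0 < p := self_mem_nhdsWithin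
  have hlt : ∀ᶠ p : ℝ in nhdsWithin 0 (Set.Ioi 0), p < 1 :=
    (eventually_lt_nhds zero_lt_one).filter_mono nhdsWithin_le_nhds
  have hNε := hN.eventually_le_const hε
  have hQ : Filter.Tendsto (qStar ε) (nhdsWithin 0 (Set.Ioi 0)) (nhds 0) := by
    have hbound : Filter.Tendsto (fun p : ℝ => (ε + Real.log 2) / -Real.log p)
        (nhdsWithin 0 (Set.Ioi 0)) (nhds 0) := hM.const_div_atTop _
    refine tendsto_of_tendsto_of_tendsto_of_le_of_le' tendsto_const_nhds hbound ?_ ?_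
    · filter_upwards [hpos, hlt, hNε] with p h0 h1 h2 using (qStar_spec h0 h1 h2).1.1
    · filter_upwards [hpos, hlt, hNε] with p h0 h1 h2
      obtain ⟨hmem, hle, -⟩ := qStar_spec h0 h1 h2
      rw [bernKL_eq_sub_binEntropy h0 h1] at hle
      rw [le_div_iff₀ (neg_pos.2 (Real.log_neg h0 h1))]
      have hN0 : 0 ≤ -Real.log (1 - p) :=
        neg_nonneg.2 (Real.log_nonpos (by linarith) (by linarith))
      linarith [Real.binEntropy_le_log_two (p := qStar ε p),
        mul_nonneg (sub_nonneg.2 hmem.2) hN0]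
  have hh : Filter.Tendsto (fun p => Real.binEntropy (qStar ε p)) (nhdsWithin 0 (Set.Ioi 0))
      (nhds 0) := by
    simpa [Function.comp_def] using (Real.binEntropy_continuous.tendsto 0).comp hQ
  have hlim : Filter.Tendsto (fun p => (qStar ε p * Real.log ε +
      (ε - (1 - qStar ε p) * (-Real.log (1 - p)) + Real.binEntropy (qStar ε p))) / ε)
      (nhdsWithin 0 (Set.Ioi 0)) (nhds 1) := by
    have := (((hQ.mul_const (Real.log ε)).add
      (((hQ.const_sub 1).mul hN).const_sub ε |>.add hh)).div_const ε)
    simpa [hε.ne'] using this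
  refine hlim.congr' ?_
  filter_upwards [hpos, hlt, hNε, hQ.eventually_lt_const zero_lt_one] with p h0 h1 h2 h3
  have heq := (qStar_spec h0 h1 h2).2.2 h3
  rw [bernKL_eq_sub_binEntropy h0 h1] at heq
  rw [Real.log_div hε.ne' h0.ne']
  congr 1
  linarith
end

section
/- For all p ∈ (0, 1/2] and q ∈ (0, 1/2], the Bernoulli KL divergence satisfies the two-sided bound q·log(q/p) − q − q² ≤ d(q,p) ≤ q·log(q/p) − q + q² + 2p. -/
/-- For all `p ∈ (0, 1/2]` and `q ∈ (0, 1/2]`,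
`q·log(q/p) − q − q² ≤ d(q,p) ≤ q·log(q/p) − q + q² + 2p`. -/
theorem stmt3 (p q : ℝ) (hp : p ∈ Set.Ioc (0:ℝ) (1/2)) (hq : q ∈ Set.Ioc (0:ℝ) (1/2)) :
    q * Real.log (q / p) - q - q ^ 2 ≤ bernKL q p ∧
      bernKL q p ≤ q * Real.log (q / p) - q + q ^ 2 + 2 * p := by
  obtain ⟨hp0, hp1⟩ := hp
  obtain ⟨hq0, hq1⟩ := hq
  have hp' : 0 < 1 - p := by linarith
  have hq' : 0 < 1 - q := by linarith
  have hlogp : Real.log (1 - p) ≤ 0 := Real.log_nonpos hp'.le (by linarith)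
  have hlogp_lower : -(2 * p) ≤ Real.log (1 - p) := by
    refine le_trans ?_ (Real.one_sub_inv_le_log_of_pos hp')
    have h : (1 - p)⁻¹ ≤ 1 + 2 * p := by
      rw [inv_le_iff_one_le_mul₀ hp']
      nlinarith
    linarith
  have hlogq_upper : (1 - q) * Real.log (1 - q) ≤ (1 - q) * (-q) :=
    mul_le_mul_of_nonneg_left (by linarith [Real.log_le_sub_one_of_pos hq']) hq'.le
  have hlogq_lower : -q ≤ (1 - q) * Real.log (1 - q) := by
    have h := mul_le_mul_of_nonneg_left (Real.one_sub_inv_le_log_of_pos hq') hq'.le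
    rw [mul_sub, mul_inv_cancel₀ hq'.ne'] at h
    linarith
  rw [bernKL, Real.log_div hq'.ne' hp'.ne']
  constructor <;> nlinarith
end

section
/- For every ε > 0 there exists p₀ ∈ (0,1) such that for all p ∈ (0, p₀), the point q₀ = ε/log(ε/p) satisfies d(q₀, p) < ε, and consequently q*(p) ≥ ε/log(ε/p). -/
/-- For every `ε > 0` there exists `p₀ ∈ (0,1)` such that for all `p ∈ (0, p₀)`,
the point `q₀ = ε/log(ε/p)` satisfies `d(q₀, p) < ε`, and consequently
`q*(p) ≥ ε/log(ε/p)`. -/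
theorem stmt5 (ε : ℝ) (hε : 0 < ε) :
    ∃ p₀ ∈ Set.Ioo (0:ℝ) 1, ∀ p ∈ Set.Ioo (0:ℝ) p₀,
      bernKL (ε / Real.log (ε / p)) p < ε ∧ ε / Real.log (ε / p) ≤ qStar ε p := by
  refine ⟨min (1 / 2) (ε * Real.exp (-(1 + ε))), ⟨by positivity, ?_⟩, ?_⟩
  · exact (min_le_left _ _).trans_lt (by norm_num)
  rintro p ⟨hp, hp₀⟩
  obtain ⟨hp₁, hp₂⟩ := lt_min_iff.1 hp₀
  have hεp : 0 < ε / p := div_pos hε hp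
  have hL : 1 + ε < Real.log (ε / p) := by
    rw [Real.lt_log_iff_exp_lt hεp, lt_div_iff₀ hp]
    calc Real.exp (1 + ε) * p < Real.exp (1 + ε) * (ε * Real.exp (-(1 + ε))) := by gcongr
      _ = ε := by rw [Real.exp_neg]; field_simp
  have hLp : Real.log (ε / p) ≤ ε / p := Real.log_le_self hεp.le
  set L := Real.log (ε / p) with hLdef
  have hL₀ : 0 < L := by linarith
  have hq₀ : 0 < ε / L := div_pos hε hL₀
  have hq₁ : ε / L < 1 := (div_lt_one hL₀).2 (by linarith)
  have hpq : p ≤ ε / L := (le_div_comm₀ hL₀ hp).1 hLp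
  have hlog : Real.log (ε / L / p) = L - Real.log L := by
    rw [div_right_comm, Real.log_div hεp.ne' hL₀.ne']
  have hfirst : ε / L * Real.log (ε / L / p) < ε := by
    have hpos : 0 < ε / L * Real.log L := mul_pos hq₀ (Real.log_pos (by linarith))
    have hcancel : ε / L * L = ε := div_mul_cancel₀ ε hL₀.ne'
    rw [hlog, mul_sub]
    linarith
  have hsecond : (1 - ε / L) * Real.log ((1 - ε / L) / (1 - p)) ≤ 0 := by
    refine mul_nonpos_of_nonneg_of_nonpos (by linarith) (Real.log_nonpos ?_ ?_)
    · exact div_nonneg (by linarith) (by linarith)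
    · exact div_le_one_of_le₀ (by linarith) (by linarith)
  have hd : bernKL (ε / L) p < ε := by
    unfold bernKL
    linarith
  exact ⟨hd, le_csSup ⟨1, fun q hq => hq.1.2⟩ ⟨⟨hq₀.le, hq₁.le⟩, hd.le⟩⟩
end

section
/- For every ε > 0 and every a > 1 there exists p₀ ∈ (0,1) such that for all p ∈ (0, p₀), writing L = log(ε/p), the point q_a = ε/(L − a·log L) satisfies d(q_a, p) > ε, and consequently q*(p) < ε/(L − a·log L). -/
theorem mul_log_sub_one_le_bernKL {q p : ℝ} (hp0 : 0 < p) (hp1 : p < 1) (hq1 : q ≤ 1) :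
    q * (Real.log (q / p) - 1) ≤ bernKL q p := by
  unfold bernKL
  rcases hq1.eq_or_lt with rfl | hq
  · simp
  · have h1 : 0 < 1 - q := by linarith
    have h2 : 0 < 1 - p := by linarith
    have h3 := Real.one_sub_inv_le_log_of_pos (div_pos h1 h2)
    have h4 := mul_le_mul_of_nonneg_left h3 h1.le
    have h5 : (1 - q) * (1 - ((1 - q) / (1 - p))⁻¹) = p - q := by
      field_simp
      ring
    linarith

theorem lt_mul_log_sub_one {ε p b : ℝ} (hε : 0 < ε) (hp : 0 < p)
    (hL : 1 < Real.log (ε / p)) (hbL : 1 < (b - 1) * Real.log (Real.log (ε / p)))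
    (hD : 0 < Real.log (ε / p) - b * Real.log (Real.log (ε / p))) :
    ε < ε / (Real.log (ε / p) - b * Real.log (Real.log (ε / p))) *
      (Real.log (ε / (Real.log (ε / p) - b * Real.log (Real.log (ε / p))) / p) - 1) := by
  set L := Real.log (ε / p) with hLdef
  set D := L - b * Real.log L with hDdef
  have hlog : 0 < Real.log L := Real.log_pos hL
  have hDL : D ≤ L := by nlinarith
  have h1 : Real.log (ε / D / p) = L - Real.log D := by
    rw [div_right_comm, Real.log_div (by positivity) hD.ne']
  have h2 : Real.log D ≤ Real.log L := Real.log_le_log hD hDL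
  rw [h1, div_mul_eq_mul_div, lt_div_iff₀ hD]
  exact mul_lt_mul_of_pos_left (by linarith) hε

theorem mul_log_sub_one_mono {p x y : ℝ} (hp : 0 < p) (hx : 0 < x) (hxy : x ≤ y)
    (h : 0 ≤ Real.log (x / p) - 1) :
    x * (Real.log (x / p) - 1) ≤ y * (Real.log (y / p) - 1) := by
  have : Real.log (x / p) ≤ Real.log (y / p) := Real.log_le_log (by positivity) (by gcongr)
  gcongr
  linarith

theorem tendsto_sub_mul_log_atTop (a : ℝ) :
    Filter.Tendsto (fun x : ℝ => x - a * Real.log x) Filter.atTop Filter.atTop := by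
  have h := (Real.isLittleO_log_id_atTop.const_mul_left a).bound (show (0 : ℝ) < 1 / 2 by norm_num)
  refine Filter.tendsto_atTop_mono' _ ?_
    (Filter.tendsto_id.const_mul_atTop (show (0 : ℝ) < 1 / 2 by norm_num))
  filter_upwards [h, Filter.eventually_ge_atTop 0] with x hx hx0
  simp only [id, Real.norm_eq_abs, abs_of_nonneg hx0] at hx ⊢
  linarith [le_abs_self (a * Real.log x)]

theorem tendsto_log_div_nhdsGT_zero {ε : ℝ} (hε : 0 < ε) :
    Filter.Tendsto (fun p : ℝ => Real.log (ε / p)) (nhdsWithin 0 (Set.Ioi 0)) Filter.atTop := by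
  simp only [div_eq_mul_inv]
  exact Real.tendsto_log_atTop.comp (tendsto_inv_nhdsGT_zero.const_mul_atTop hε)

/-- For every `ε > 0` and `a > 1` there exists `p₀ ∈ (0,1)` such that for all
`p ∈ (0, p₀)`, writing `L = log(ε/p)`, the point `q_a = ε/(L − a·log L)` satisfies
`d(q_a, p) > ε`, and consequently `q*(p) < ε/(L − a·log L)`. -/
theorem stmt6 (ε a : ℝ) (hε : 0 < ε) (ha : 1 < a) :
    ∃ p₀ ∈ Set.Ioo (0:ℝ) 1, ∀ p ∈ Set.Ioo (0:ℝ) p₀,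
      ε < bernKL (ε / (Real.log (ε / p) - a * Real.log (Real.log (ε / p)))) p ∧
        qStar ε p < ε / (Real.log (ε / p) - a * Real.log (Real.log (ε / p))) := by
  obtain ⟨b, hb, hba⟩ := exists_between ha
  have hT := tendsto_log_div_nhdsGT_zero hε
  have hev := ((hT.eventually_gt_atTop 1).and
    (((Real.tendsto_log_atTop.comp hT).const_mul_atTop
      (sub_pos.2 hb)).eventually_gt_atTop 1)).and
    (((tendsto_sub_mul_log_atTop a).comp hT).eventually_ge_atTop ε)
  obtain ⟨u, hu, hsub⟩ := mem_nhdsGT_iff_exists_Ioo_subset.1 hev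
  refine ⟨min u (1 / 2), ⟨lt_min hu (by norm_num), by simp; norm_num⟩, ?_⟩
  rintro p ⟨hp, hpu⟩
  have hp1 : p < 1 := by linarith [hpu.trans_le (min_le_right _ _)]
  obtain ⟨⟨hL, hbL⟩, hD⟩ := hsub ⟨hp, hpu.trans_le (min_le_left _ _)⟩
  simp only [Function.comp] at hL hbL hD
  have hlog : 0 < Real.log (Real.log (ε / p)) := Real.log_pos hL
  have hDa : 0 < Real.log (ε / p) - a * Real.log (Real.log (ε / p)) := hε.trans_le hD
  have hlt : Real.log (ε / p) - a * Real.log (Real.log (ε / p)) <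
      Real.log (ε / p) - b * Real.log (Real.log (ε / p)) := by
    gcongr
  have hDb := hDa.trans hlt
  have hqa := lt_mul_log_sub_one hε hp hL (by nlinarith) hDa
  have hqb := lt_mul_log_sub_one hε hp hL hbL hDb
  refine ⟨hqa.trans_le (mul_log_sub_one_le_bernKL hp hp1 ((div_le_one hDa).2 hD)), ?_⟩
  refine lt_of_le_of_lt ?_ (div_lt_div_of_pos_left hε hDa hlt)
  have hq := div_pos hε hDb
  refine Real.sSup_le ?_ hq.le
  rintro x ⟨⟨-, hx1⟩, hx⟩
  by_contra! hqx
  have hpos := pos_of_mul_pos_right (hε.trans hqb) hq.le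
  linarith [mul_log_sub_one_mono hp hq hqx.le hpos.le,
    mul_log_sub_one_le_bernKL hp hp1 hx1]
end

section
/- Let K ≥ 3, fix two distinct indices 1 and i* in [K], and let Δ_a^{priv} > 0 for each a ≠ 1 and Δ_a^{pub} > 0 for each a ≠ i* be real constants. For w in the simplex over [K]∖{i*}, define Γ(w) = min{ min_{a ∉ {1, i*}} √(w₁w_a)·(Δ_a^{priv})²/(√w₁·Δ_a^{pub} + √w_a·Δ₁^{pub}), √w₁·(Δ_{i*}^{priv})²/Δ₁^{pub} }. Then at any maximizer w* of Γ over the simplex, all terms corresponding to arms a ∉ {1, i*} are equal, i.e. for all a, a' ∉ {1, i*}: √(w₁*w_a*)·(Δ_a^{priv})²/(√w₁*·Δ_a^{pub} + √w_a*·Δ₁^{pub}) = √(w₁*w_{a'}*)·(Δ_{a'}^{priv})²/(√w₁*·Δ_{a'}^{pub} + √w_{a'}*·Δ₁^{pub}), and moreover √w₁*·(Δ_{i*}^{priv})²/Δ₁^{pub} ≥ √(w₁*w_a*)·(Δ_a^{priv})²/(√w₁*·Δ_a^{pub} + √w_a*·Δ₁^{pub}) for all a ∉ {1, i*}. -/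
/-- The information term of arm `a` for allocation `w`:
`√(w₁·w_a)·(Δ_a^{priv})²/(√w₁·Δ_a^{pub} + √w_a·Δ₁^{pub})`. -/
noncomputable def infoTerm {K : ℕ} (one : Fin K) (Δpriv Δpub : Fin K → ℝ)
    (w : Fin K → ℝ) (a : Fin K) : ℝ :=
  Real.sqrt (w one * w a) * Δpriv a ^ 2 /
    (Real.sqrt (w one) * Δpub a + Real.sqrt (w a) * Δpub one)

/-- `Γ(w)`: the minimum of the information terms over arms `a ∉ {1, i*}` together with
the term `√w₁·(Δ_{i*}^{priv})²/Δ₁^{pub}`. -/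
noncomputable def Gamma {K : ℕ} (one istar : Fin K) (Δpriv Δpub : Fin K → ℝ)
    (w : Fin K → ℝ) : ℝ :=
  min (sInf {r : ℝ | ∃ a : Fin K, a ≠ one ∧ a ≠ istar ∧ r = infoTerm one Δpriv Δpub w a})
    (Real.sqrt (w one) * Δpriv istar ^ 2 / Δpub one)

/-- The simplex over `[K] ∖ {i*}`, realized as nonnegative weight vectors on `[K]`
vanishing at `i*` and summing to one. -/
def simplexOff {K : ℕ} (istar : Fin K) : Set (Fin K → ℝ) :=
  {w | (∀ a, 0 ≤ w a) ∧ w istar = 0 ∧ ∑ a, w a = 1}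

theorem finite_infoTerm_set {K : ℕ} (one istar : Fin K) (Δpriv Δpub w : Fin K → ℝ) :
    {r : ℝ | ∃ a : Fin K, a ≠ one ∧ a ≠ istar ∧ r = infoTerm one Δpriv Δpub w a}.Finite :=
  (Set.finite_range (infoTerm one Δpriv Δpub w)).subset
    (by rintro _ ⟨a, -, -, rfl⟩; exact ⟨a, rfl⟩)

theorem Gamma_le_infoTerm {K : ℕ} {one istar : Fin K} {Δpriv Δpub w : Fin K → ℝ} {a : Fin K}
    (ha : a ≠ one) (ha' : a ≠ istar) :
    Gamma one istar Δpriv Δpub w ≤ infoTerm one Δpriv Δpub w a :=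
  (min_le_left _ _).trans
    (csInf_le (finite_infoTerm_set one istar Δpriv Δpub w).bddBelow ⟨a, ha, ha', rfl⟩)

theorem lt_Gamma {K : ℕ} {one istar : Fin K} {Δpriv Δpub w : Fin K → ℝ} {c : ℝ}
    (hex : ∃ a : Fin K, a ≠ one ∧ a ≠ istar)
    (hterm : ∀ a, a ≠ one → a ≠ istar → c < infoTerm one Δpriv Δpub w a)
    (hstar : c < √(w one) * Δpriv istar ^ 2 / Δpub one) :
    c < Gamma one istar Δpriv Δpub w := by
  refine lt_min ?_ hstar
  obtain ⟨a, ha, ha'⟩ := hex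
  have hnonempty : {r : ℝ | ∃ a : Fin K, a ≠ one ∧ a ≠ istar ∧
      r = infoTerm one Δpriv Δpub w a}.Nonempty := ⟨_, a, ha, ha', rfl⟩
  obtain ⟨b, hb, hb', h⟩ :=
    hnonempty.csInf_mem (finite_infoTerm_set one istar Δpriv Δpub w)
  rw [h]
  exact hterm b hb hb'

theorem Gamma_pos_of_pos {K : ℕ} {one istar : Fin K} {Δpriv Δpub w : Fin K → ℝ}
    (hne : one ≠ istar) (hex : ∃ a : Fin K, a ≠ one ∧ a ≠ istar)
    (hpriv : ∀ a, a ≠ one → 0 < Δpriv a) (hpub : ∀ a, a ≠ istar → 0 < Δpub a)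
    (hw : ∀ a, a ≠ istar → 0 < w a) :
    0 < Gamma one istar Δpriv Δpub w := by
  have h1 := hw one hne
  have hpub1 := hpub one hne
  refine lt_Gamma hex (fun a ha ha' => ?_) ?_
  · have := hw a ha'
    have := hpriv a ha
    have := hpub a ha'
    unfold infoTerm
    positivity
  · have := hpriv istar hne.symm
    positivity

theorem uniform_mem_simplexOff {K : ℕ} (hK : 2 ≤ K) (istar : Fin K) :
    (fun a => if a = istar then 0 else ((K : ℝ) - 1)⁻¹) ∈ simplexOff istar := by
  have hK' : (2 : ℝ) ≤ K := by exact_mod_cast hK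
  refine ⟨fun a => ?_, by simp, ?_⟩
  · dsimp only
    split_ifs
    · exact le_rfl
    · exact inv_nonneg.mpr (by linarith)
  · rw [← Finset.add_sum_erase _ _ (Finset.mem_univ istar),
      Finset.sum_congr rfl fun a ha => if_neg (Finset.ne_of_mem_erase ha)]
    simp only [if_true, Finset.sum_const, Finset.card_erase_of_mem (Finset.mem_univ istar),
      Finset.card_univ, Fintype.card_fin, nsmul_eq_mul, zero_add]
    rw [Nat.cast_sub (by omega), Nat.cast_one]
    exact mul_inv_cancel₀ (by linarith)

/-- An information term is strictly increasing in the weight of the first arm. -/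
theorem infoTerm_lt_of_one_lt {K : ℕ} {one a : Fin K} {Δpriv Δpub w w' : Fin K → ℝ}
    (h1 : 0 < w one) (ha : 0 < w a) (hwa : w' a = w a) (hw1 : w one < w' one)
    (hpriv : 0 < Δpriv a) (hpub : 0 < Δpub a) (hpub1 : 0 < Δpub one) :
    infoTerm one Δpriv Δpub w a < infoTerm one Δpriv Δpub w' a := by
  have hlt := Real.sqrt_lt_sqrt h1.le hw1
  have hs := Real.sqrt_pos.mpr h1
  have ht := Real.sqrt_pos.mpr ha
  have hs' := hs.trans hlt
  unfold infoTerm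
  rw [hwa, Real.sqrt_mul h1.le, Real.sqrt_mul (h1.trans hw1).le,
    div_lt_div_iff₀ (by positivity) (by positivity)]
  have h : 0 < √(w a) ^ 2 * Δpriv a ^ 2 * Δpub one * (√(w' one) - √(w one)) :=
    mul_pos (by positivity) (sub_pos.mpr hlt)
  linear_combination h

/-- Move mass `ε` from arm `b` to arm `c`. -/
def transfer {K : ℕ} (w : Fin K → ℝ) (b c : Fin K) (ε : ℝ) : Fin K → ℝ :=
  fun a => w a + (if a = c then ε else 0) - (if a = b then ε else 0)

theorem transfer_mem_simplexOff {K : ℕ} {istar b c : Fin K} {w : Fin K → ℝ} {ε : ℝ}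
    (hw : w ∈ simplexOff istar) (hbc : b ≠ c) (hb : b ≠ istar) (hc : c ≠ istar)
    (hε : 0 ≤ ε) (hεb : ε ≤ w b) : transfer w b c ε ∈ simplexOff istar := by
  obtain ⟨hw0, hwi, hwsum⟩ := hw
  refine ⟨fun a => ?_, by simp [transfer, hwi, hb.symm, hc.symm], ?_⟩
  · have := hw0 a
    unfold transfer
    by_cases hab : a = b
    · subst hab
      simp [hbc, hεb]
    · rw [if_neg hab]
      split_ifs <;> linarith
  · simp [transfer, Finset.sum_add_distrib, hwsum]

theorem tendsto_infoTerm_transfer {K : ℕ} {one b : Fin K} {Δpriv Δpub w : Fin K → ℝ}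
    (hb : b ≠ one) (h1 : 0 < w one) (hwb : 0 < w b)
    (hpub : 0 < Δpub b) (hpub1 : 0 < Δpub one) :
    Filter.Tendsto (fun ε => infoTerm one Δpriv Δpub (transfer w b one ε) b) (nhds 0)
      (nhds (infoTerm one Δpriv Δpub w b)) := by
  have hcont : ContinuousAt
      (fun ε => infoTerm one Δpriv Δpub (transfer w b one ε) b) 0 := by
    simp only [infoTerm, transfer, hb, hb.symm, if_true, if_false]
    refine ContinuousAt.div (by fun_prop) (by fun_prop) (ne_of_gt ?_)
    simp only [add_zero, sub_zero]
    positivity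
  have h0 : transfer w b one 0 = w := by ext; simp [transfer]
  simpa only [ContinuousAt, h0] using hcont

/-- Information balance at any maximizer of `Γ` over the simplex: all information
terms of arms `a ∉ {1, i*}` are equal, and the `i*`-term is at least each of them. -/
theorem stmt17 (K : ℕ) (hK : 3 ≤ K) (one istar : Fin K) (hne : one ≠ istar)
    (Δpriv Δpub : Fin K → ℝ)
    (hpriv : ∀ a, a ≠ one → 0 < Δpriv a) (hpub : ∀ a, a ≠ istar → 0 < Δpub a)
    (wstar : Fin K → ℝ) (hwstar : wstar ∈ simplexOff istar)
    (hmax : ∀ w ∈ simplexOff istar,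
      Gamma one istar Δpriv Δpub w ≤ Gamma one istar Δpriv Δpub wstar) :
    (∀ a a', a ≠ one → a ≠ istar → a' ≠ one → a' ≠ istar →
      infoTerm one Δpriv Δpub wstar a = infoTerm one Δpriv Δpub wstar a') ∧
    (∀ a, a ≠ one → a ≠ istar →
      infoTerm one Δpriv Δpub wstar a
        ≤ Real.sqrt (wstar one) * Δpriv istar ^ 2 / Δpub one) := by
  have hpub1 : 0 < Δpub one := hpub one hne
  obtain ⟨a₀, ha₀, ha₀'⟩ : ∃ a : Fin K, a ≠ one ∧ a ≠ istar := by
    obtain ⟨a, ha⟩ : ∃ a, a ∉ ({one, istar} : Finset (Fin K)) := by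
      by_contra! h
      have h₁ := Finset.card_le_card (fun a (_ : a ∈ Finset.univ) => h a)
      have h₂ : ({one, istar} : Finset (Fin K)).card ≤ 2 := Finset.card_le_two
      simp only [Finset.card_univ, Fintype.card_fin] at h₁
      omega
    exact ⟨a, by simpa using ha⟩
  have hΓ := (Gamma_pos_of_pos hne ⟨a₀, ha₀, ha₀'⟩ hpriv hpub
    (w := fun a => if a = istar then 0 else ((K : ℝ) - 1)⁻¹)
    (fun a ha => by
      have : (3 : ℝ) ≤ K := by exact_mod_cast hK
      simp only [ha, if_false]
      exact inv_pos.mpr (by linarith))).trans_le (hmax _ (uniform_mem_simplexOff (by omega) istar))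
  obtain ⟨hw0, hwi, hwsum⟩ := hwstar
  have hpos : ∀ a, a ≠ one → a ≠ istar → 0 < wstar one ∧ 0 < wstar a := by
    intro a ha ha'
    have h := hΓ.trans_le (Gamma_le_infoTerm ha ha')
    constructor <;> refine lt_of_le_of_ne (hw0 _) fun h0 => ?_ <;>
      simp [infoTerm, ← h0] at h
  have h1 := (hpos a₀ ha₀ ha₀').1
  have key : ∀ b, b ≠ one → b ≠ istar →
      infoTerm one Δpriv Δpub wstar b = Gamma one istar Δpriv Δpub wstar := by
    intro b hb hb'
    refine le_antisymm (le_of_not_gt fun hlt => ?_) (Gamma_le_infoTerm hb hb')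
    obtain ⟨ε, ⟨hε, hεb⟩, hεΓ⟩ := (Filter.Eventually.and (Ioo_mem_nhdsGT (hpos b hb hb').2)
      (((tendsto_infoTerm_transfer hb h1 (hpos b hb hb').2 (hpub b hb') hpub1).eventually
        (lt_mem_nhds hlt)).filter_mono nhdsWithin_le_nhds)).exists
    refine (hmax (transfer wstar b one ε)
      (transfer_mem_simplexOff ⟨hw0, hwi, hwsum⟩ hb hb' hne hε.le hεb.le)).not_gt ?_
    have h1ε : transfer wstar b one ε one = wstar one + ε := by
      simp [transfer, hb.symm]
    refine lt_Gamma ⟨a₀, ha₀, ha₀'⟩ (fun a ha ha' => ?_) ?_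
    · by_cases hab : a = b
      · rwa [hab]
      · refine (Gamma_le_infoTerm ha ha').trans_lt
          (infoTerm_lt_of_one_lt h1 (hpos a ha ha').2 ?_ ?_ (hpriv a ha) (hpub a ha') hpub1)
        · simp [transfer, ha, hab]
        · rw [h1ε]; linarith
    · refine (min_le_right _ _).trans_lt ?_
      have := hpriv istar hne.symm
      have : √(wstar one) < √(transfer wstar b one ε one) :=
        Real.sqrt_lt_sqrt h1.le (by rw [h1ε]; linarith)
      gcongr
  exact ⟨fun a a' ha ha' hb hb' => (key a ha ha').trans (key a' hb hb').symm,
    fun a ha ha' => (key a ha ha').trans_le (min_le_right _ _)⟩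
end

section
/- Let K ≥ 3, fix two distinct indices 1 and i* in [K], and let Δ_a^{priv} > 0 for each a ≠ 1 and Δ_a^{pub} > 0 for each a ≠ i* be real constants. For w in the simplex over [K]∖{i*}, define Γ(w) = min{ min_{a ∉ {1, i*}} √(w₁w_a)·(Δ_a^{priv})²/(√w₁·Δ_a^{pub} + √w_a·Δ₁^{pub}), √w₁·(Δ_{i*}^{priv})²/Δ₁^{pub} }. Then Γ attains its maximum over the simplex, and the maximizer w* is unique. -/
theorem Gamma_eq_min_inf' {K : ℕ} {one istar : Fin K} (Δpriv Δpub w : Fin K → ℝ)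
    (h : (Finset.univ.filter fun a : Fin K => a ≠ one ∧ a ≠ istar).Nonempty) :
    Gamma one istar Δpriv Δpub w =
      min ((Finset.univ.filter fun a : Fin K => a ≠ one ∧ a ≠ istar).inf' h
        (infoTerm one Δpriv Δpub w)) (Real.sqrt (w one) * Δpriv istar ^ 2 / Δpub one) := by
  rw [Gamma, Finset.inf'_eq_csInf_image]
  congr 2
  ext r
  simp [and_assoc, eq_comm]

theorem sqrt_mul_mul_div_eq {P Q R u v : ℝ} (hu : 0 < u) (hv : 0 < v) :
    Real.sqrt (u * v) * P / (Real.sqrt u * Q + Real.sqrt v * R) =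
      P / (Q * (Real.sqrt v)⁻¹ + R * (Real.sqrt u)⁻¹) := by
  have hx := Real.sqrt_pos.2 hu
  have hy := Real.sqrt_pos.2 hv
  have h : Real.sqrt u * Q + Real.sqrt v * R =
      (Q * (Real.sqrt v)⁻¹ + R * (Real.sqrt u)⁻¹) * (Real.sqrt u * Real.sqrt v) := by
    field_simp
  rw [h, Real.sqrt_mul hu.le, mul_comm _ P, mul_div_mul_right _ _ (by positivity)]

theorem sqrt_mul_mul_div_le {P Q R u v : ℝ} (hP : 0 ≤ P) (hQ : 0 < Q) (hR : 0 ≤ R)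
    (hu : 0 ≤ u) :
    Real.sqrt (u * v) * P / (Real.sqrt u * Q + Real.sqrt v * R) ≤ Real.sqrt v * P / Q := by
  have hy := Real.sqrt_nonneg v
  rw [Real.sqrt_mul hu]
  rcases hu.eq_or_lt with rfl | hu
  · simp; positivity
  have hx := Real.sqrt_pos.2 hu
  rw [div_le_div_iff₀ (by positivity) hQ]
  have : 0 ≤ Real.sqrt v * P * (Real.sqrt v * R) := by positivity
  linarith

theorem inv_sqrt_lt_inv_sqrt {u v : ℝ} (hu : 0 < u) (h : u < v) :
    (Real.sqrt v)⁻¹ < (Real.sqrt u)⁻¹ :=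
  inv_strictAnti₀ (Real.sqrt_pos.2 hu) (Real.sqrt_lt_sqrt hu.le h)

theorem inv_sqrt_midpoint_lt {u v : ℝ} (hu : 0 < u) (hv : 0 < v) (h : u ≠ v) :
    (Real.sqrt ((u + v) / 2))⁻¹ < ((Real.sqrt u)⁻¹ + (Real.sqrt v)⁻¹) / 2 := by
  have hx := Real.sqrt_pos.2 hu
  have hy := Real.sqrt_pos.2 hv
  have hxy : Real.sqrt u ≠ Real.sqrt v := fun e => h ((Real.sqrt_inj hu.le hv.le).1 e)
  have hsq := sq_pos_of_ne_zero (sub_ne_zero.2 hxy)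
  have hs : (Real.sqrt u + Real.sqrt v) / 2 < Real.sqrt ((u + v) / 2) := by
    apply Real.lt_sqrt_of_sq_lt
    nlinarith [Real.sq_sqrt hu.le, Real.sq_sqrt hv.le]
  refine (inv_strictAnti₀ (by positivity) hs).trans ?_
  rw [inv_div, ← sub_pos]
  have : ((Real.sqrt u)⁻¹ + (Real.sqrt v)⁻¹) / 2 - 2 / (Real.sqrt u + Real.sqrt v) =
      (Real.sqrt u - Real.sqrt v) ^ 2 /
        (2 * Real.sqrt u * Real.sqrt v * (Real.sqrt u + Real.sqrt v)) := by
    field_simp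
    ring
  rw [this]
  positivity

theorem inv_sqrt_midpoint_le {u v : ℝ} (hu : 0 < u) (hv : 0 < v) :
    (Real.sqrt ((u + v) / 2))⁻¹ ≤ ((Real.sqrt u)⁻¹ + (Real.sqrt v)⁻¹) / 2 := by
  rcases eq_or_ne u v with rfl | h
  · simp
  · exact (inv_sqrt_midpoint_lt hu hv h).le

theorem continuousOn_infoTerm {K : ℕ} {one : Fin K} {Δpriv Δpub : Fin K → ℝ} {a : Fin K}
    (ha : 0 < Δpub a) (hone : 0 < Δpub one) :
    ContinuousOn (fun w => infoTerm one Δpriv Δpub w a) {w | ∀ b, 0 ≤ w b} := by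
  intro w hw
  by_cases h : Real.sqrt (w one) * Δpub a + Real.sqrt (w a) * Δpub one = 0
  · have hx := mul_nonneg (Real.sqrt_nonneg (w one)) ha.le
    have hy := mul_nonneg (Real.sqrt_nonneg (w a)) hone.le
    have hwa : Real.sqrt (w a) = 0 := by
      have : Real.sqrt (w a) * Δpub one = 0 := by linarith
      simpa [hone.ne'] using this
    have hz : infoTerm one Δpriv Δpub w a = 0 := by simp [infoTerm, h]
    have hc : ContinuousWithinAt (fun v : Fin K → ℝ => Real.sqrt (v a) * Δpriv a ^ 2 / Δpub a)
        {w | ∀ b, 0 ≤ w b} w :=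
      Continuous.continuousWithinAt (by fun_prop)
    unfold ContinuousWithinAt at hc ⊢
    simp only [hz]
    simp only [hwa, zero_mul, zero_div] at hc
    refine tendsto_of_tendsto_of_tendsto_of_le_of_le' tendsto_const_nhds hc ?_ ?_
    · filter_upwards with v
      unfold infoTerm
      positivity
    · filter_upwards [self_mem_nhdsWithin] with v hv
      exact sqrt_mul_mul_div_le (sq_nonneg _) ha hone.le (hv one)
  · exact ContinuousAt.continuousWithinAt (ContinuousAt.div (by fun_prop) (by fun_prop) h)

theorem isCompact_simplexOff {K : ℕ} (istar : Fin K) : IsCompact (simplexOff istar) := by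
  have : simplexOff istar = stdSimplex ℝ (Fin K) ∩ {w | w istar = 0} := by
    ext w
    simp only [simplexOff, stdSimplex, Set.mem_ofPred_eq, Set.mem_inter_iff]
    tauto
  rw [this]
  exact (isCompact_stdSimplex ℝ (Fin K)).inter_right
    (isClosed_eq (continuous_apply istar) continuous_const)

section

variable {K : ℕ} {one istar : Fin K} {Δpriv Δpub w : Fin K → ℝ} {c : ℝ}

theorem continuousOn_Gamma (hne : one ≠ istar) (hpub : ∀ a, a ≠ istar → 0 < Δpub a)
    (h : (Finset.univ.filter fun a : Fin K => a ≠ one ∧ a ≠ istar).Nonempty) :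
    ContinuousOn (Gamma one istar Δpriv Δpub) {w | ∀ b, 0 ≤ w b} := by
  rw [funext fun w => Gamma_eq_min_inf' Δpriv Δpub w h]
  refine ContinuousOn.inf (ContinuousOn.finset_inf'_apply h fun a ha => ?_)
    (Continuous.continuousOn (by fun_prop))
  exact continuousOn_infoTerm (hpub a (by simpa using (Finset.mem_filter.1 ha).2.2))
    (hpub one hne)

theorem pos_of_Gamma_pos
    (h : (Finset.univ.filter fun a : Fin K => a ≠ one ∧ a ≠ istar).Nonempty)
    (hw : ∀ b, 0 ≤ w b) (hG : 0 < Gamma one istar Δpriv Δpub w) {a : Fin K} (ha : a ≠ istar) :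
    0 < w a := by
  rw [Gamma_eq_min_inf' Δpriv Δpub w h, lt_min_iff, Finset.lt_inf'_iff] at hG
  refine (hw a).lt_of_ne fun h0 => ?_
  rcases eq_or_ne a one with rfl | h1
  · simpa [← h0] using hG.2
  · simpa [infoTerm, ← h0] using hG.1 a (by simp [h1, ha])

theorem lt_infoTerm_iff (hone : 0 < Δpub one) (hwone : 0 < w one) {a : Fin K}
    (ha : 0 < Δpub a) (hwa : 0 < w a) :
    c < infoTerm one Δpriv Δpub w a ↔
      c * (Δpub a * (Real.sqrt (w a))⁻¹ + Δpub one * (Real.sqrt (w one))⁻¹) < Δpriv a ^ 2 := by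
  have := Real.sqrt_pos.2 hwone
  have := Real.sqrt_pos.2 hwa
  rw [infoTerm, sqrt_mul_mul_div_eq hwone hwa, lt_div_iff₀ (by positivity)]

theorem le_infoTerm_iff (hone : 0 < Δpub one) (hwone : 0 < w one) {a : Fin K}
    (ha : 0 < Δpub a) (hwa : 0 < w a) :
    c ≤ infoTerm one Δpriv Δpub w a ↔
      c * (Δpub a * (Real.sqrt (w a))⁻¹ + Δpub one * (Real.sqrt (w one))⁻¹) ≤ Δpriv a ^ 2 := by
  have := Real.sqrt_pos.2 hwone
  have := Real.sqrt_pos.2 hwa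
  rw [infoTerm, sqrt_mul_mul_div_eq hwone hwa, le_div_iff₀ (by positivity)]

theorem sqrt_mul_div_eq {P R u : ℝ} (hu : 0 < u) :
    Real.sqrt u * P / R = P / (R * (Real.sqrt u)⁻¹) := by
  have := Real.sqrt_pos.2 hu
  field_simp

theorem lt_Gamma_iff (hpub : ∀ a, a ≠ istar → 0 < Δpub a) (hne : one ≠ istar)
    (h : (Finset.univ.filter fun a : Fin K => a ≠ one ∧ a ≠ istar).Nonempty)
    (hw : ∀ a, a ≠ istar → 0 < w a) :
    c < Gamma one istar Δpriv Δpub w ↔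
      (∀ a, a ≠ one → a ≠ istar →
        c * (Δpub a * (Real.sqrt (w a))⁻¹ + Δpub one * (Real.sqrt (w one))⁻¹) < Δpriv a ^ 2) ∧
      c * (Δpub one * (Real.sqrt (w one))⁻¹) < Δpriv istar ^ 2 := by
  have hR := hpub one hne
  have hx := Real.sqrt_pos.2 (hw one hne)
  rw [Gamma_eq_min_inf' Δpriv Δpub w h, lt_min_iff, Finset.lt_inf'_iff,
    sqrt_mul_div_eq (hw one hne), lt_div_iff₀ (by positivity)]
  refine and_congr_left' (forall_congr' fun a => ?_)
  simp only [Finset.mem_filter, Finset.mem_univ, true_and, and_imp]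
  exact forall₂_congr fun _ h2 => lt_infoTerm_iff hR (hw one hne) (hpub a h2) (hw a h2)

theorem le_Gamma_iff (hpub : ∀ a, a ≠ istar → 0 < Δpub a) (hne : one ≠ istar)
    (h : (Finset.univ.filter fun a : Fin K => a ≠ one ∧ a ≠ istar).Nonempty)
    (hw : ∀ a, a ≠ istar → 0 < w a) :
    c ≤ Gamma one istar Δpriv Δpub w ↔
      (∀ a, a ≠ one → a ≠ istar →
        c * (Δpub a * (Real.sqrt (w a))⁻¹ + Δpub one * (Real.sqrt (w one))⁻¹) ≤ Δpriv a ^ 2) ∧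
      c * (Δpub one * (Real.sqrt (w one))⁻¹) ≤ Δpriv istar ^ 2 := by
  have hR := hpub one hne
  have hx := Real.sqrt_pos.2 (hw one hne)
  rw [Gamma_eq_min_inf' Δpriv Δpub w h, le_min_iff, Finset.le_inf'_iff,
    sqrt_mul_div_eq (hw one hne), le_div_iff₀ (by positivity)]
  refine and_congr_left' (forall_congr' fun a => ?_)
  simp only [Finset.mem_filter, Finset.mem_univ, true_and, and_imp]
  exact forall₂_congr fun _ h2 => le_infoTerm_iff hR (hw one hne) (hpub a h2) (hw a h2)

/-- Slack at arm `a` allows moving weight from `a` to `one`, which improves every other term. -/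
theorem exists_lt_Gamma_of_lt (hpub : ∀ a, a ≠ istar → 0 < Δpub a) (hne : one ≠ istar)
    (h : (Finset.univ.filter fun a : Fin K => a ≠ one ∧ a ≠ istar).Nonempty)
    (hmem : w ∈ simplexOff istar) (hw : ∀ a, a ≠ istar → 0 < w a) (hc : 0 < c)
    (hle : c ≤ Gamma one istar Δpriv Δpub w) {a : Fin K} (h1 : a ≠ one) (h2 : a ≠ istar)
    (hlt : c * (Δpub a * (Real.sqrt (w a))⁻¹ + Δpub one * (Real.sqrt (w one))⁻¹) <
      Δpriv a ^ 2) :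
    ∃ v ∈ simplexOff istar, c < Gamma one istar Δpriv Δpub v := by
  have hR := hpub one hne
  have hwone := hw one hne
  have hwa := hw a h2
  have hcont : ContinuousAt (fun ε : ℝ => c * (Δpub a * (Real.sqrt (w a - ε))⁻¹ +
      Δpub one * (Real.sqrt (w one + ε))⁻¹)) 0 := by
    have := (Real.sqrt_pos.2 hwone).ne'
    have := (Real.sqrt_pos.2 hwa).ne'
    refine continuousAt_const.mul ((continuousAt_const.mul (ContinuousAt.inv₀ ?_ ?_)).add
      (continuousAt_const.mul (ContinuousAt.inv₀ ?_ ?_))) <;> first | fun_prop | simpa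
  have hev := hcont.tendsto.eventually_lt_const (u := Δpriv a ^ 2) (by simpa using hlt)
  obtain ⟨ε, ⟨hε, hεa⟩, hε0⟩ := (((hev.filter_mono nhdsWithin_le_nhds).and
    ((eventually_lt_nhds hwa).filter_mono nhdsWithin_le_nhds)).and
      (self_mem_nhdsWithin (s := Set.Ioi (0 : ℝ)))).exists
  replace hε0 : 0 < ε := hε0
  let v : Fin K → ℝ := fun b => w b + ((if b = one then ε else 0) - if b = a then ε else 0)
  have hvone : v one = w one + ε := by simp [v, h1.symm]
  have hva : v a = w a - ε := by simp [v, h1, sub_eq_add_neg]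
  have hvb : ∀ b, b ≠ one → b ≠ a → v b = w b := fun b hb hb' => by simp [v, hb, hb']
  have hv : ∀ b, b ≠ istar → 0 < v b := by
    intro b hb
    rcases eq_or_ne b one with rfl | hb1
    · rw [hvone]; positivity
    rcases eq_or_ne b a with rfl | hba
    · rw [hva]; linarith
    · rw [hvb b hb1 hba]; exact hw b hb
  have hvstar : v istar = 0 := by rw [hvb istar hne.symm h2.symm]; exact hmem.2.1
  refine ⟨v, ⟨fun b => ?_, hvstar, ?_⟩, ?_⟩
  · rcases eq_or_ne b istar with rfl | hb
    · exact hvstar.ge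
    · exact (hv b hb).le
  · simp [v, Finset.sum_add_distrib, hmem.2.2]
  rw [le_Gamma_iff hpub hne h hw] at hle
  have hg : c * (Δpub one * (Real.sqrt (v one))⁻¹) < c * (Δpub one * (Real.sqrt (w one))⁻¹) := by
    have := inv_sqrt_lt_inv_sqrt hwone (show w one < v one by linarith)
    gcongr
  refine (lt_Gamma_iff hpub hne h hv).2 ⟨fun b hb hb' => ?_, hg.trans_le hle.2⟩
  rcases eq_or_ne b a with rfl | hba
  · rwa [hva, hvone]
  · rw [hvb b hb hba]
    linarith [hle.1 b hb hb']

theorem midpoint_constraint_le {Q R u v u' v' : ℝ} {P : ℝ} (hc : 0 ≤ c) (hQ : 0 ≤ Q)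
    (hR : 0 ≤ R) (hu : 0 < u) (hv : 0 < v) (hu' : 0 < u') (hv' : 0 < v')
    (h : c * (Q * (Real.sqrt u)⁻¹ + R * (Real.sqrt v)⁻¹) ≤ P)
    (h' : c * (Q * (Real.sqrt u')⁻¹ + R * (Real.sqrt v')⁻¹) ≤ P) :
    c * (Q * (Real.sqrt ((u + u') / 2))⁻¹ + R * (Real.sqrt ((v + v') / 2))⁻¹) ≤ P := by
  have := inv_sqrt_midpoint_le hu hu'
  have := inv_sqrt_midpoint_le hv hv'
  calc c * (Q * (Real.sqrt ((u + u') / 2))⁻¹ + R * (Real.sqrt ((v + v') / 2))⁻¹)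
      ≤ c * (Q * (((Real.sqrt u)⁻¹ + (Real.sqrt u')⁻¹) / 2) +
          R * (((Real.sqrt v)⁻¹ + (Real.sqrt v')⁻¹) / 2)) := by gcongr
    _ ≤ P := by linarith

theorem midpoint_constraint_lt {Q R u v u' v' : ℝ} {P : ℝ} (hc : 0 < c) (hQ : 0 < Q)
    (hR : 0 < R) (hu : 0 < u) (hv : 0 < v) (hu' : 0 < u') (hv' : 0 < v')
    (hne : u ≠ u' ∨ v ≠ v')
    (h : c * (Q * (Real.sqrt u)⁻¹ + R * (Real.sqrt v)⁻¹) ≤ P)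
    (h' : c * (Q * (Real.sqrt u')⁻¹ + R * (Real.sqrt v')⁻¹) ≤ P) :
    c * (Q * (Real.sqrt ((u + u') / 2))⁻¹ + R * (Real.sqrt ((v + v') / 2))⁻¹) < P := by
  have hmu := inv_sqrt_midpoint_le hu hu'
  have hmv := inv_sqrt_midpoint_le hv hv'
  calc c * (Q * (Real.sqrt ((u + u') / 2))⁻¹ + R * (Real.sqrt ((v + v') / 2))⁻¹)
      < c * (Q * (((Real.sqrt u)⁻¹ + (Real.sqrt u')⁻¹) / 2) +
          R * (((Real.sqrt v)⁻¹ + (Real.sqrt v')⁻¹) / 2)) := by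
        refine mul_lt_mul_of_pos_left ?_ hc
        rcases hne with hne | hne
        · have := inv_sqrt_midpoint_lt hu hu' hne
          exact add_lt_add_of_lt_of_le (by gcongr) (by gcongr)
        · have := inv_sqrt_midpoint_lt hv hv' hne
          exact add_lt_add_of_le_of_lt (by gcongr) (by gcongr)
    _ ≤ P := by linarith

theorem exists_Gamma_pos (hne : one ≠ istar) (hpriv : ∀ a, a ≠ one → 0 < Δpriv a)
    (hpub : ∀ a, a ≠ istar → 0 < Δpub a)
    (h : (Finset.univ.filter fun a : Fin K => a ≠ one ∧ a ≠ istar).Nonempty) :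
    ∃ w ∈ simplexOff istar, 0 < Gamma one istar Δpriv Δpub w := by
  let s : Finset (Fin K) := Finset.univ.erase istar
  have hs : (0 : ℝ) < s.card := by
    exact_mod_cast Finset.card_pos.2 ⟨one, by simp [s, hne]⟩
  let w : Fin K → ℝ := fun a => if a ∈ s then (s.card : ℝ)⁻¹ else 0
  have hw : ∀ a, a ≠ istar → 0 < w a := fun a ha => by
    simp only [w, s, Finset.mem_erase, Finset.mem_univ, ha, ne_eq, not_false_eq_true, and_self,
      if_true]
    exact inv_pos.2 hs
  refine ⟨w, ⟨fun a => ?_, by simp [w, s], ?_⟩, (lt_Gamma_iff hpub hne h hw).2 ⟨?_, ?_⟩⟩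
  · simp only [w]
    split_ifs <;> positivity
  · simp [w, hs.ne']
  · intro a ha _
    simpa using pow_pos (hpriv a ha) 2
  · simpa using pow_pos (hpriv istar hne.symm) 2

end

/-- `Γ` attains its maximum over the simplex, and the maximizer is unique. -/
theorem stmt18 (K : ℕ) (hK : 3 ≤ K) (one istar : Fin K) (hne : one ≠ istar)
    (Δpriv Δpub : Fin K → ℝ)
    (hpriv : ∀ a, a ≠ one → 0 < Δpriv a) (hpub : ∀ a, a ≠ istar → 0 < Δpub a) :
    ∃! wstar : Fin K → ℝ, wstar ∈ simplexOff istar ∧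
      ∀ w ∈ simplexOff istar,
        Gamma one istar Δpriv Δpub w ≤ Gamma one istar Δpriv Δpub wstar := by
  have h : (Finset.univ.filter fun a : Fin K => a ≠ one ∧ a ≠ istar).Nonempty := by
    obtain ⟨a, ha⟩ := Finset.exists_mem_notMem_of_card_lt_card
      (s := {one, istar}) (t := (Finset.univ : Finset (Fin K)))
      (by rw [Finset.card_pair hne, Finset.card_univ, Fintype.card_fin]; omega)
    exact ⟨a, by simpa using ha⟩
  obtain ⟨u, hu, hGu⟩ := exists_Gamma_pos hne hpriv hpub h
  obtain ⟨w, hw, hmax⟩ := (isCompact_simplexOff istar).exists_isMaxOn ⟨u, hu⟩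
    ((continuousOn_Gamma (Δpriv := Δpriv) hne hpub h).mono fun v hv => hv.1)
  replace hmax : ∀ v ∈ simplexOff istar,
      Gamma one istar Δpriv Δpub v ≤ Gamma one istar Δpriv Δpub w := hmax
  refine ⟨w, ⟨hw, hmax⟩, fun v ⟨hv, hvmax⟩ => ?_⟩
  have hc : 0 < Gamma one istar Δpriv Δpub w := hGu.trans_le (hmax u hu)
  have hwv := hvmax w hw
  have hwpos : ∀ a, a ≠ istar → 0 < w a := fun a => pos_of_Gamma_pos h hw.1 hc
  have hvpos : ∀ a, a ≠ istar → 0 < v a := fun a =>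
    pos_of_Gamma_pos h hv.1 (hc.trans_le hwv)
  have hR := hpub one hne
  have hlew := (le_Gamma_iff hpub hne h hwpos).1
    (le_refl (Gamma one istar Δpriv Δpub w))
  have hlev := (le_Gamma_iff hpub hne h hvpos).1 hwv
  let m : Fin K → ℝ := fun a => (v a + w a) / 2
  have hmpos : ∀ a, a ≠ istar → 0 < m a := fun a ha =>
    half_pos (add_pos (hvpos a ha) (hwpos a ha))
  have hm : m ∈ simplexOff istar := by
    refine ⟨fun a => ?_, by simp [m, hv.2.1, hw.2.1], ?_⟩
    · have := hv.1 a
      have := hw.1 a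
      positivity
    · simp [m, ← Finset.sum_div, Finset.sum_add_distrib, hv.2.2, hw.2.2]
  have hlem : Gamma one istar Δpriv Δpub w ≤ Gamma one istar Δpriv Δpub m := by
    refine (le_Gamma_iff hpub hne h hmpos).2 ⟨fun a h1 h2 => ?_, ?_⟩
    · exact midpoint_constraint_le hc.le (hpub a h2).le hR.le (hvpos a h2) (hvpos one hne)
        (hwpos a h2) (hwpos one hne) (hlev.1 a h1 h2) (hlew.1 a h1 h2)
    · simpa only [zero_mul, zero_add] using midpoint_constraint_le (Q := 0) hc.le le_rfl hR.le one_pos (hvpos one hne)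
        one_pos (hwpos one hne) (by simpa using hlev.2) (by simpa using hlew.2)
  have key : ∀ a, a ≠ one → a ≠ istar → v a = w a ∧ v one = w one := by
    intro a h1 h2
    by_contra hcon
    obtain ⟨x, hx, hlt⟩ := exists_lt_Gamma_of_lt hpub hne h hm hmpos hc hlem h1 h2
      (midpoint_constraint_lt hc (hpub a h2) hR (hvpos a h2) (hvpos one hne)
        (hwpos a h2) (hwpos one hne) (not_and_or.1 hcon) (hlev.1 a h1 h2) (hlew.1 a h1 h2))
    exact hlt.not_ge (hmax x hx)
  obtain ⟨b, hb⟩ := h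
  rw [Finset.mem_filter] at hb
  funext a
  rcases eq_or_ne a istar with rfl | h2
  · rw [hv.2.1, hw.2.1]
  rcases eq_or_ne a one with rfl | h1
  · exact (key b hb.2.1 hb.2.2).2
  · exact (key a h1 h2).1
end
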